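/- arXiv:1709.10038 — 4 statements merged into one kernel-verified Lean document; each statement's English description precedes it below -/
import Mathlib

section
/- Let Ω0 be a symmetric p×p real matrix with weighted degrees d_j := Σ_{k=1}^p |Ω0_{jk}|, let U be a p×p real matrix, and let (λ_T)_{T∈ℕ} be a sequence of real numbers such that √T·λ_T → λ0 as T → ∞. Then T·λ_T·(‖Ω0 + U/√T‖²_{1,2} − ‖Ω0‖²_{1,2}) converges to 2·λ0·Σ_{i=1}^p Σ_{j=1}^p g_{ij}·d_j as T → ∞. -/
open Filter

/-- The squared mixed L₁,₂ norm of a matrix: ∑_j (∑_i |A_{ij}|)². -/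
def L12sq {m n : ℕ} (A : Matrix (Fin m) (Fin n) ℝ) : ℝ :=
  ∑ j, (∑ i, |A i j|) ^ 2

/-- g(a,u) = u·sign(a) if a ≠ 0, and |u| if a = 0. -/
noncomputable def gfun (a u : ℝ) : ℝ :=
  if a ≠ 0 then u * Real.sign a else |u|

/-- `g a u` is the right derivative at `0` of `t ↦ |a + t * u|`. -/
theorem hasDerivWithinAt_abs_add_mul (a u : ℝ) :
    HasDerivWithinAt (fun t : ℝ => |a + t * u|) (gfun a u) (Set.Ioi 0) 0 := by
  have hlin : HasDerivAt (fun t : ℝ => a + t * u) u 0 := by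
    simpa using ((hasDerivAt_id (0 : ℝ)).mul_const u).const_add a
  by_cases ha : a = 0
  · subst ha
    have h : HasDerivWithinAt (fun t : ℝ => t * |u|) (gfun 0 u) (Set.Ioi 0) 0 := by
      simpa [gfun] using ((hasDerivAt_id (0 : ℝ)).mul_const |u|).hasDerivWithinAt
    refine h.congr (fun t ht => ?_) (by simp)
    rw [zero_add, abs_mul, abs_of_pos ht]
  · rcases lt_or_gt_of_ne ha with hneg | hpos
    · have h := (hasDerivAt_abs_neg (x := a + 0 * u) (by simpa using hneg)).comp 0 hlin
      simpa [gfun, ha, Real.sign_of_neg hneg, Function.comp_def] using h.hasDerivWithinAt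
    · have h := (hasDerivAt_abs_pos (x := a + 0 * u) (by simpa using hpos)).comp 0 hlin
      simpa [gfun, ha, Real.sign_of_pos hpos, Function.comp_def] using h.hasDerivWithinAt

/-- The right derivative at `0` of the squared mixed norm along the ray `t ↦ A + t • U`. -/
theorem hasDerivWithinAt_L12sq_add_smul {m n : ℕ} (A U : Matrix (Fin m) (Fin n) ℝ) :
    HasDerivWithinAt (fun t : ℝ => L12sq (A + t • U))
      (∑ j, 2 * (∑ i, |A i j|) * ∑ i, gfun (A i j) (U i j)) (Set.Ioi 0) 0 := by
  have h := HasDerivWithinAt.fun_sum (u := Finset.univ) fun j _ =>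
    (HasDerivWithinAt.fun_sum (u := Finset.univ) fun i _ =>
      hasDerivWithinAt_abs_add_mul (A i j) (U i j)).fun_pow 2
  simpa [L12sq] using h

/-- asymptotics of the rescaled SGLASSO penalty increment. -/
theorem sglasso_penalty_limit (p : ℕ) (Ω0 U : Matrix (Fin p) (Fin p) ℝ)
    (hsym : ∀ i j, Ω0 i j = Ω0 j i)
    (d : Fin p → ℝ) (hd : ∀ j, d j = ∑ k, |Ω0 j k|)
    (lam : ℕ → ℝ) (lam0 : ℝ)
    (hlam : Tendsto (fun T : ℕ => Real.sqrt T * lam T) atTop (nhds lam0)) :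
    Tendsto
      (fun T : ℕ =>
        (T : ℝ) * lam T * (L12sq (Ω0 + (Real.sqrt T)⁻¹ • U) - L12sq Ω0))
      atTop (nhds (2 * lam0 * ∑ i, ∑ j, gfun (Ω0 i j) (U i j) * d j)) := by
  have hcol (j : Fin p) : ∑ i, |Ω0 i j| = d j := by
    rw [hd]
    exact Finset.sum_congr rfl fun i _ => by rw [hsym]
  have hsum : ∑ j, 2 * (∑ i, |Ω0 i j|) * ∑ i, gfun (Ω0 i j) (U i j)
      = 2 * ∑ i, ∑ j, gfun (Ω0 i j) (U i j) * d j := by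
    rw [Finset.sum_comm, Finset.mul_sum]
    refine Finset.sum_congr rfl fun j _ => ?_
    rw [hcol, ← Finset.sum_mul]
    ring
  have hstep : Tendsto (fun T : ℕ => (Real.sqrt T)⁻¹) atTop (nhdsWithin 0 (Set.Ioi 0)) :=
    tendsto_inv_atTop_nhdsGT_zero.comp
      (Real.tendsto_sqrt_atTop.comp tendsto_natCast_atTop_atTop)
  have hderiv := hasDerivWithinAt_L12sq_add_smul Ω0 U
  rw [hsum, hasDerivWithinAt_iff_tendsto_slope' (by simp)] at hderiv
  have hlim := hlam.mul (hderiv.comp hstep)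
  convert hlim using 2 with T
  · have hT : (T : ℝ) = Real.sqrt T * Real.sqrt T := (Real.mul_self_sqrt T.cast_nonneg).symm
    simp only [Function.comp_apply, slope_def_field, sub_zero, zero_smul, add_zero, div_inv_eq_mul]
    nth_rewrite 1 [hT]
    ring
  · ring
end

section
/- Let Ω0 be a symmetric p×p real matrix with weighted degrees d_j := Σ_{k=1}^p |Ω0_{jk}|, let D_p be the p×p matrix whose (i,j) entry is d_j, let U be a p×p real matrix, and let (λ_T)_{T∈ℕ} be a sequence of real numbers with √T·λ_T → λ0 as T → ∞. Then the difference between the rescaled SGLASSO and degree-weighted GLASSO penalty increments vanishes: T·[λ_T·(‖Ω0 + U/√T‖²_{1,2} − ‖Ω0‖²_{1,2}) − 2·λ_T·(‖D_p ∘ (Ω0 + U/√T)‖_{1,1} − ‖D_p ∘ Ω0‖_{1,1})] → 0 as T → ∞. -/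
open Filter

/-- The L₁,₁ norm of a matrix: ∑_j ∑_i |A_{ij}|. -/
def L11 {m n : ℕ} (A : Matrix (Fin m) (Fin n) ℝ) : ℝ :=
  ∑ j, ∑ i, |A i j|

/-- Weighting each entry of column `j` by a nonnegative `w j` weights the column sum by `w j`. -/
lemma L11_mul_left {m n : ℕ} (w : Fin n → ℝ) (hw : ∀ j, 0 ≤ w j)
    (A : Matrix (Fin m) (Fin n) ℝ) :
    L11 (fun i j => w j * A i j) = ∑ j, w j * ∑ i, |A i j| := by
  simp only [L11, abs_mul, abs_of_nonneg (hw _), Finset.mul_sum]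

/-- The linearization error of `L12sq` in the absolute column sums. -/
lemma L12sq_sub_linearization {m n : ℕ} (A B : Matrix (Fin m) (Fin n) ℝ) :
    L12sq A - L12sq B
        - 2 * (L11 (fun i j => (∑ k, |B k j|) * A i j) - L11 (fun i j => (∑ k, |B k j|) * B i j))
      = ∑ j, (∑ i, |A i j| - ∑ i, |B i j|) ^ 2 := by
  have hw : ∀ j, 0 ≤ ∑ k, |B k j| := fun j => Finset.sum_nonneg fun k _ => abs_nonneg _
  rw [L11_mul_left _ hw, L11_mul_left _ hw, L12sq, L12sq, ← Finset.sum_sub_distrib,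
    ← Finset.sum_sub_distrib, Finset.mul_sum, ← Finset.sum_sub_distrib]
  exact Finset.sum_congr rfl fun j _ => by ring

lemma sum_sq_column_sub_le {m n : ℕ} (B U : Matrix (Fin m) (Fin n) ℝ) (c : ℝ) :
    ∑ j, (∑ i, |(B + c • U) i j| - ∑ i, |B i j|) ^ 2 ≤ c ^ 2 * L12sq U := by
  rw [L12sq, Finset.mul_sum]
  refine Finset.sum_le_sum fun j _ => ?_
  rw [← mul_pow, sq_le_sq, ← Finset.sum_sub_distrib, abs_mul,
    abs_of_nonneg (Finset.sum_nonneg fun i _ => abs_nonneg (U i j)), Finset.mul_sum]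
  refine (Finset.abs_sum_le_sum_abs _ _).trans (Finset.sum_le_sum fun i _ => ?_)
  simpa [abs_mul] using abs_abs_sub_abs_le_abs_sub (B i j + c * U i j) (B i j)

/-- the rescaled SGLASSO and degree-weighted GLASSO penalty increments
are asymptotically equivalent. -/
theorem sglasso_glasso_equivalence (p : ℕ) (Ω0 U : Matrix (Fin p) (Fin p) ℝ)
    (hsym : ∀ i j, Ω0 i j = Ω0 j i)
    (d : Fin p → ℝ) (hd : ∀ j, d j = ∑ k, |Ω0 j k|)
    (D : Matrix (Fin p) (Fin p) ℝ) (hD : ∀ i j, D i j = d j)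
    (lam : ℕ → ℝ) (lam0 : ℝ)
    (hlam : Tendsto (fun T : ℕ => Real.sqrt T * lam T) atTop (nhds lam0)) :
    Tendsto
      (fun T : ℕ =>
        (T : ℝ) *
          (lam T * (L12sq (Ω0 + (Real.sqrt T)⁻¹ • U) - L12sq Ω0)
            - 2 * lam T *
              (L11 (fun i j => D i j * (Ω0 + (Real.sqrt T)⁻¹ • U) i j)
                - L11 (fun i j => D i j * Ω0 i j))))
      atTop (nhds 0) := by
  have hweight : ∀ i j, D i j = ∑ k, |Ω0 k j| := fun i j => by
    rw [hD, hd]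
    exact Finset.sum_congr rfl fun k _ => by rw [hsym]
  have hlam_zero : Tendsto lam atTop (nhds 0) := by
    have hinv : Tendsto (fun T : ℕ => (Real.sqrt T)⁻¹) atTop (nhds 0) :=
      tendsto_inv_atTop_zero.comp (Real.tendsto_sqrt_atTop.comp tendsto_natCast_atTop_atTop)
    have hprod := hinv.mul hlam
    rw [zero_mul] at hprod
    refine hprod.congr' ?_
    filter_upwards [eventually_gt_atTop 0] with T hT
    have : Real.sqrt T ≠ 0 := (Real.sqrt_pos.2 (Nat.cast_pos.2 hT)).ne'
    rw [inv_mul_cancel_left₀ this]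
  have hbound : Tendsto (fun T => |lam T| * L12sq U) atTop (nhds 0) := by
    simpa using hlam_zero.abs.mul_const (L12sq U)
  refine squeeze_zero_norm' ?_ hbound
  filter_upwards [eventually_gt_atTop 0] with T hT
  have hTpos : (0 : ℝ) < T := Nat.cast_pos.2 hT
  simp only [hweight]
  rw [mul_assoc, mul_left_comm 2, ← mul_sub, L12sq_sub_linearization, mul_left_comm,
    Real.norm_eq_abs, abs_mul]
  refine mul_le_mul_of_nonneg_left ?_ (abs_nonneg _)
  rw [abs_of_nonneg (mul_nonneg hTpos.le (Finset.sum_nonneg fun j _ => sq_nonneg _))]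
  refine (mul_le_mul_of_nonneg_left (sum_sq_column_sub_le Ω0 U _) hTpos.le).trans_eq ?_
  rw [inv_pow, Real.sq_sqrt hTpos.le, mul_inv_cancel_left₀ hTpos.ne']
end

section
/- Let Ω0 be a p×p real symmetric positive definite matrix, Σ0 := Ω0⁻¹, U a symmetric p×p real matrix, d_j := Σ_{k=1}^p |Ω0_{jk}|, and D_p the p×p matrix whose (i,j) entry is d_j. Let (Σ̂_T)_{T∈ℕ} be p×p real matrices and W a p×p real matrix with √T·(Σ̂_T − Σ0) → W entrywise, and let (λ_T) satisfy √T·λ_T → λ0 ≥ 0. Define V_T^l(U) := −log det(Ω0 + U/√T) + tr((Ω0 + U/√T)·Σ̂_T) + 2·λ_T·‖D_p ∘ (Ω0 + U/√T)‖_{1,1} + log det Ω0 − tr(Ω0·Σ̂_T) − 2·λ_T·‖D_p ∘ Ω0‖_{1,1}. Then T·V_T^l(U) converges, as T → ∞, to (1/2)·tr(U Σ0 U Σ0) + tr(U W) + 2·λ0·Σ_{i=1}^p Σ_{j=1}^p g_{ij}·d_j. -/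
open Filter

open scoped Topology in
/-- Second-order expansion of `log (1 + s * y s)` at `s = 0`. -/
theorem tendsto_log_one_add_mul_sub_div_sq {y : ℝ → ℝ} {a : ℝ} (hy : Tendsto y (𝓝[≠] 0) (𝓝 a)) :
    Tendsto (fun s => (Real.log (1 + s * y s) - s * y s) / s ^ 2) (𝓝[≠] 0) (𝓝 (-(a ^ 2 / 2))) := by
  have hs : Tendsto (fun s : ℝ => s) (𝓝[≠] 0) (𝓝 0) := tendsto_nhdsWithin_of_tendsto_nhds tendsto_id
  have hx : Tendsto (fun s => |s * y s|) (𝓝[≠] 0) (𝓝 0) := by simpa using (hs.mul hy).abs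
  have hbound : Tendsto (fun s => |s| * |y s| ^ 3 / (1 - |s * y s|)) (𝓝[≠] 0) (𝓝 0) := by
    have h := (hs.abs.mul (hy.abs.pow 3)).div (tendsto_const_nhds.sub hx)
      (sub_ne_zero.2 (one_ne_zero (α := ℝ)))
    rwa [abs_zero, zero_mul, zero_div] at h
  have hrem : Tendsto (fun s => (Real.log (1 + s * y s) - s * y s) / s ^ 2 + y s ^ 2 / 2)
      (𝓝[≠] 0) (𝓝 0) := by
    refine squeeze_zero_norm' ?_ hbound
    filter_upwards [hx.eventually_lt_const one_pos, self_mem_nhdsWithin] with s hlt hne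
    have hne : s ≠ 0 := hne
    have h := Real.abs_log_sub_add_sum_range_le (x := -(s * y s)) (by rwa [abs_neg]) 2
    have hfactor : (Real.log (1 + s * y s) - s * y s) / s ^ 2 + y s ^ 2 / 2 =
        ((∑ i ∈ Finset.range 2, (-(s * y s)) ^ (i + 1) / ((i : ℝ) + 1)) +
          Real.log (1 - -(s * y s))) / s ^ 2 := by
      rw [sub_neg_eq_add, Finset.sum_range_succ, Finset.sum_range_one]
      field_simp
      push_cast
      ring
    rw [Real.norm_eq_abs, hfactor, abs_div, abs_of_nonneg (sq_nonneg s),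
      div_le_iff₀ (by positivity)]
    refine h.trans_eq ?_
    rw [abs_neg, abs_mul, ← sq_abs s]
    ring
  have h := hrem.sub ((hy.pow 2).div_const 2)
  simpa using h

/-- Second-order expansion of the determinant at the identity. -/
theorem Matrix.exists_det_one_add_smul_eq {n : Type*} [Fintype n] [DecidableEq n]
    (M : Matrix n n ℝ) :
    ∃ c : ℝ → ℝ, Continuous c ∧ (∀ s, (1 + s • M).det = 1 + M.trace * s + c s * s ^ 2) ∧
      c 0 = (M.trace ^ 2 - (M * M).trace) / 2 := by
  obtain ⟨c, hc, hdet⟩ : ∃ c : ℝ → ℝ, Continuous c ∧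
      ∀ s, (1 + s • M).det = 1 + M.trace * s + c s * s ^ 2 :=
    ⟨_, Polynomial.continuous _, fun s => Matrix.det_one_add_smul s M⟩
  obtain ⟨e, he, hdet_sq⟩ : ∃ e : ℝ → ℝ, Continuous e ∧
      ∀ s, (1 + s • (M * M)).det = 1 + (M * M).trace * s + e s * s ^ 2 :=
    ⟨_, Polynomial.continuous _, fun s => Matrix.det_one_add_smul s (M * M)⟩
  refine ⟨c, hc, hdet, ?_⟩
  have hprod (s : ℝ) : (1 + s • M).det * (1 + (-s) • M).det = (1 + (-s ^ 2) • (M * M)).det := by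
    rw [← Matrix.det_mul]
    congr 1
    simp only [add_mul, mul_add, one_mul, mul_one, smul_mul_assoc, mul_smul_comm]
    module
  have heq : ∀ s ∈ ({0}ᶜ : Set ℝ), c s + c (-s) - M.trace ^ 2 +
      s * (M.trace * (c (-s) - c s) + s * (c s * c (-s))) =
      -(M * M).trace + e (-s ^ 2) * s ^ 2 := by
    intro s hs
    have h := hprod s
    rw [hdet, hdet, hdet_sq] at h
    have hs2 : s ^ 2 ≠ 0 := pow_ne_zero 2 hs
    apply mul_right_cancel₀ hs2
    linear_combination h
  have hext := Continuous.ext_on (dense_compl_singleton (0 : ℝ)) (by fun_prop) (by fun_prop) heq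
  have h0 := congrFun hext 0
  simp only [neg_zero, zero_mul, ne_eq, OfNat.ofNat_ne_zero, not_false_eq_true, zero_pow,
    mul_zero, add_zero] at h0
  linarith

open scoped Topology in
/-- Second-order expansion of the log-determinant at the identity. -/
theorem Matrix.tendsto_log_det_one_add_smul {n : Type*} [Fintype n] [DecidableEq n]
    (M : Matrix n n ℝ) :
    Tendsto (fun s : ℝ => (Real.log (1 + s • M).det - s * M.trace) / s ^ 2) (𝓝[≠] 0)
      (𝓝 (-((M * M).trace / 2))) := by
  obtain ⟨c, hc, hdet, hc0⟩ := M.exists_det_one_add_smul_eq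
  have hcs : Tendsto c (𝓝[≠] 0) (𝓝 (c 0)) := hc.continuousAt.continuousWithinAt
  have hy : Tendsto (fun s => M.trace + s * c s) (𝓝[≠] 0) (𝓝 M.trace) := by
    have : Continuous fun s => M.trace + s * c s := by fun_prop
    simpa using (this.continuousAt (x := 0)).continuousWithinAt (s := {0}ᶜ) |>.tendsto
  have h := (tendsto_log_one_add_mul_sub_div_sq hy).add hcs
  rw [hc0, show -(M.trace ^ 2 / 2) + (M.trace ^ 2 - (M * M).trace) / 2 =
    -((M * M).trace / 2) by ring] at h
  refine h.congr' ?_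
  filter_upwards [self_mem_nhdsWithin] with s hs
  have hs : s ≠ 0 := hs
  rw [hdet, show 1 + M.trace * s + c s * s ^ 2 = 1 + s * (M.trace + s * c s) by ring]
  field_simp
  ring

open scoped Topology in
/-- Second-order expansion of the log-determinant at an invertible matrix. -/
theorem Matrix.tendsto_log_det_add_smul {n : Type*} [Fintype n] [DecidableEq n]
    (A U : Matrix n n ℝ) (hA : A.det ≠ 0) :
    Tendsto (fun s : ℝ => (Real.log (A + s • U).det - Real.log A.det - s * (U * A⁻¹).trace) / s ^ 2)
      (𝓝[≠] 0) (𝓝 (-((U * A⁻¹ * U * A⁻¹).trace / 2))) := by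
  have h := (U * A⁻¹).tendsto_log_det_one_add_smul
  rw [← mul_assoc] at h
  refine h.congr' ?_
  have hcont : Continuous fun s : ℝ => (1 + s • (U * A⁻¹)).det := by fun_prop
  have hne : ∀ᶠ s in 𝓝 (0 : ℝ), (1 + s • (U * A⁻¹)).det ≠ 0 :=
    hcont.continuousAt.eventually_ne (by simp)
  filter_upwards [hne.filter_mono nhdsWithin_le_nhds] with s hs
  have hfactor : A + s • U = (1 + s • (U * A⁻¹)) * A := by
    rw [add_mul, one_mul, smul_mul_assoc, mul_assoc, Matrix.nonsing_inv_mul _ hA.isUnit, mul_one]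
  rw [hfactor, Matrix.det_mul, Real.log_mul hs hA]
  ring

open scoped Topology in
/-- `gfun a u` is the one-sided directional derivative of the absolute value at `a` along `u`. -/
theorem tendsto_abs_add_mul_sub_abs_div (a u : ℝ) :
    Tendsto (fun s : ℝ => (|a + s * u| - |a|) / s) (𝓝[>] 0) (𝓝 (gfun a u)) := by
  have hlim : Tendsto (fun s : ℝ => a + s * u) (𝓝[>] 0) (𝓝 a) := by
    have : Continuous fun s : ℝ => a + s * u := by fun_prop
    simpa using (this.continuousAt (x := 0)).continuousWithinAt (s := Set.Ioi 0) |>.tendsto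
  refine tendsto_const_nhds.congr' ?_
  rcases lt_trichotomy a 0 with ha | rfl | ha
  · filter_upwards [hlim.eventually_lt_const ha, self_mem_nhdsWithin] with s hs hpos
    have hpos : 0 < s := hpos
    rw [gfun, if_pos ha.ne, Real.sign_of_neg ha, abs_of_neg ha, abs_of_neg hs]
    field_simp
    ring
  · filter_upwards [self_mem_nhdsWithin] with s hpos
    have hpos : 0 < s := hpos
    simp [gfun, abs_mul, abs_of_pos hpos, hpos.ne']
  · filter_upwards [hlim.eventually_const_lt ha, self_mem_nhdsWithin] with s hs hpos
    have hpos : 0 < s := hpos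
    rw [gfun, if_pos ha.ne', Real.sign_of_pos ha, abs_of_pos ha, abs_of_pos hs]
    field_simp
    ring

/-- limit of the rescaled degree-weighted GLASSO criterion T·V_T^l(U). -/
theorem weighted_glasso_criterion_limit (p : ℕ)
    (Ω0 Sigma0 U W : Matrix (Fin p) (Fin p) ℝ)
    (hΩ0 : Ω0.PosDef) (hSigma0 : Sigma0 = Ω0⁻¹)
    (hU : ∀ i j, U i j = U j i)
    (d : Fin p → ℝ) (hd : ∀ j, d j = ∑ k, |Ω0 j k|)
    (D : Matrix (Fin p) (Fin p) ℝ) (hD : ∀ i j, D i j = d j)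
    (Sig : ℕ → Matrix (Fin p) (Fin p) ℝ)
    (hSig : ∀ i j, Tendsto (fun T : ℕ => Real.sqrt T * (Sig T i j - Sigma0 i j))
      atTop (nhds (W i j)))
    (lam : ℕ → ℝ) (lam0 : ℝ) (hlam0 : 0 ≤ lam0)
    (hlam : Tendsto (fun T : ℕ => Real.sqrt T * lam T) atTop (nhds lam0)) :
    Tendsto
      (fun T : ℕ =>
        (T : ℝ) *
          (-Real.log (Ω0 + (Real.sqrt T)⁻¹ • U).det
            + Matrix.trace ((Ω0 + (Real.sqrt T)⁻¹ • U) * Sig T)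
            + 2 * lam T * L11 (fun i j => D i j * (Ω0 + (Real.sqrt T)⁻¹ • U) i j)
            + Real.log Ω0.det
            - Matrix.trace (Ω0 * Sig T)
            - 2 * lam T * L11 (fun i j => D i j * Ω0 i j)))
      atTop
      (nhds (1 / 2 * Matrix.trace (U * Sigma0 * U * Sigma0) + Matrix.trace (U * W)
        + 2 * lam0 * ∑ i, ∑ j, gfun (Ω0 i j) (U i j) * d j)) := by
  have hs : Tendsto (fun T : ℕ => (Real.sqrt T)⁻¹) atTop (nhdsWithin 0 (Set.Ioi 0)) :=
    tendsto_inv_atTop_nhdsGT_zero.comp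
      (Real.tendsto_sqrt_atTop.comp tendsto_natCast_atTop_atTop)
  have hlogdet := (Ω0.tendsto_log_det_add_smul U hΩ0.det_pos.ne').comp
    (hs.mono_right (nhdsWithin_mono 0 fun _ hx => ne_of_gt hx))
  have htrace : Tendsto (fun T : ℕ => Real.sqrt T * (U * (Sig T - Sigma0)).trace) atTop
      (nhds (U * W).trace) := by
    have h := tendsto_finsetSum Finset.univ fun i _ =>
      tendsto_finsetSum Finset.univ fun j _ => (hSig j i).const_mul (U i j)
    simp only [Matrix.trace, Matrix.diag, Matrix.mul_apply]
    refine h.congr fun T => ?_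
    simp only [Finset.mul_sum, Matrix.sub_apply]
    exact Finset.sum_congr rfl fun i _ => Finset.sum_congr rfl fun j _ => by ring
  have hpenalty := (hlam.const_mul 2).mul <| tendsto_finsetSum Finset.univ fun i _ =>
    tendsto_finsetSum Finset.univ fun j _ =>
      ((tendsto_abs_add_mul_sub_abs_div (Ω0 i j) (U i j)).comp hs).mul_const (d j)
  have hL11 (A : Matrix (Fin p) (Fin p) ℝ) :
      L11 (fun i j => D i j * A i j) = ∑ i, ∑ j, |A i j| * d j := by
    unfold L11
    rw [Finset.sum_comm]
    refine Finset.sum_congr rfl fun i _ => Finset.sum_congr rfl fun j _ => ?_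
    have hdj : 0 ≤ d j := hd j ▸ Finset.sum_nonneg fun k _ => abs_nonneg _
    change |D i j * A i j| = _
    rw [hD, abs_mul, abs_of_nonneg hdj, mul_comm]
  have h := (hlogdet.neg.add htrace).add hpenalty
  rw [neg_neg, ← hSigma0, div_eq_inv_mul, ← one_div] at h
  refine h.congr' ?_
  filter_upwards [eventually_gt_atTop 0] with T hT
  have hpos : 0 < Real.sqrt T := Real.sqrt_pos.2 (Nat.cast_pos.2 hT)
  have hsq : (T : ℝ) = Real.sqrt T ^ 2 := (Real.sq_sqrt (Nat.cast_nonneg T)).symm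
  have hdiff : (∑ i, ∑ j, (|Ω0 i j + (Real.sqrt T)⁻¹ * U i j| - |Ω0 i j|) / (Real.sqrt T)⁻¹ * d j) =
      Real.sqrt T * (L11 (fun i j => D i j * (Ω0 + (Real.sqrt T)⁻¹ • U) i j) -
        L11 (fun i j => D i j * Ω0 i j)) := by
    rw [hL11, hL11, ← Finset.sum_sub_distrib, Finset.mul_sum]
    refine Finset.sum_congr rfl fun i _ => ?_
    rw [← Finset.sum_sub_distrib, Finset.mul_sum]
    refine Finset.sum_congr rfl fun j _ => ?_
    rw [div_inv_eq_mul, Matrix.add_apply, Matrix.smul_apply, smul_eq_mul]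
    ring
  simp only [Function.comp_apply]
  rw [hdiff, add_mul, Matrix.trace_add, smul_mul_assoc, Matrix.trace_smul, smul_eq_mul, mul_sub,
    Matrix.trace_sub]
  rw [hsq, Real.sqrt_sq hpos.le]
  field_simp
  ring
end

section
/- Let d ∈ ℕ and let f_n : ℝ^d → ℝ (n ∈ ℕ) and f : ℝ^d → ℝ be convex functions such that f_n(x) → f(x) as n → ∞ for every x ∈ ℝ^d. Suppose x* ∈ ℝ^d is the unique global minimizer of f, i.e., f(x*) < f(x) for all x ≠ x*, and suppose for each n that x_n ∈ ℝ^d is a global minimizer of f_n, i.e., f_n(x_n) ≤ f_n(x) for all x. Then x_n → x* as n → ∞. -/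
open Filter

/-- If convex functions on a finite-dimensional space converge pointwise to a convex function `g`,
then every strict lower bound of `g y` is eventually a lower bound near `y`, locally uniformly. -/
theorem ConvexOn.eventually_prod_nhds_lt_of_tendsto {ι E : Type*} [NormedAddCommGroup E]
    [NormedSpace ℝ E] [FiniteDimensional ℝ E] {l : Filter ι} {f : ι → E → ℝ} {g : E → ℝ}
    (hf : ∀ n, ConvexOn ℝ Set.univ (f n)) (hg : ConvexOn ℝ Set.univ g)
    (hfg : ∀ x, Tendsto (fun n => f n x) l (nhds (g x))) {y : E} {c : ℝ} (hc : c < g y) :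
    ∀ᶠ p in l ×ˢ nhds y, c < f p.1 p.2 := by
  obtain ⟨ε, hε, hcε⟩ : ∃ ε > 0, c + 3 * ε = g y := ⟨(g y - c) / 3, by linarith, by ring⟩
  have hnear : {z | g z < g y + ε} ∈ nhds y :=
    hg.locallyLipschitz.continuous.continuousAt.eventually_lt_const (by linarith)
  obtain ⟨b, hyb, hb⟩ := exists_mem_interior_convexHull_affineBasis hnear
  have hvert : ∀ᶠ n in l, ∀ i, f n (b i) < g y + ε :=
    eventually_all.2 fun i => (hfg (b i)).eventually_lt_const
      (hb (subset_convexHull ℝ _ (Set.mem_range_self i)))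
  have hcenter : ∀ᶠ n in l, g y - ε < f n y := (hfg y).eventually_const_lt (by linarith)
  have hrefl : ∀ᶠ z in nhds y, (2 : ℝ) • y - z ∈ convexHull ℝ (Set.range b) := by
    have hcont : ContinuousAt (fun z => (2 : ℝ) • y - z) y := by fun_prop
    apply hcont
    have hfix : (2 : ℝ) • y - y = y := by rw [two_smul, add_sub_cancel_right]
    beta_reduce
    rw [hfix]
    exact mem_interior_iff_mem_nhds.1 hyb
  filter_upwards [(hvert.and hcenter).prod_mk hrefl]
  rintro ⟨n, z⟩ ⟨⟨hn, hny⟩, hz⟩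
  obtain ⟨_, ⟨i, rfl⟩, hi⟩ := (hf n).exists_ge_of_mem_convexHull (Set.subset_univ _) hz
  have hmid := (hf n).2 (Set.mem_univ z) (Set.mem_univ ((2 : ℝ) • y - z))
    (by norm_num : (0 : ℝ) ≤ 1 / 2) (by norm_num : (0 : ℝ) ≤ 1 / 2) (by norm_num)
  have hyz : (1 / 2 : ℝ) • z + (1 / 2 : ℝ) • ((2 : ℝ) • y - z) = y := by module
  rw [hyz] at hmid
  simp only [smul_eq_mul] at hmid
  have := hn i
  dsimp only at hny ⊢
  linarith

/-- A convex function larger on a sphere than at its center has all its minimizers in the open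
ball. -/
theorem ConvexOn.dist_lt_of_forall_sphere_lt {E : Type*} [NormedAddCommGroup E]
    [NormedSpace ℝ E] {f : E → ℝ} (hf : ConvexOn ℝ Set.univ f) {x₀ x : E} {r : ℝ} (hr : 0 < r)
    (hsphere : ∀ z ∈ Metric.sphere x₀ r, f x₀ < f z) (hx : f x ≤ f x₀) : dist x x₀ < r := by
  by_contra! hle
  have hpos : 0 < dist x x₀ := hr.trans_le hle
  set t := r / dist x x₀ with ht
  have ht₁ : t ≤ 1 := (div_le_one hpos).2 hle
  have hz : AffineMap.lineMap x₀ x t ∈ Metric.sphere x₀ r := by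
    rw [Metric.mem_sphere, dist_lineMap_left, Real.norm_of_nonneg (by positivity), dist_comm x₀ x,
      ht, div_mul_cancel₀ _ hpos.ne']
  have hseg : AffineMap.lineMap x₀ x t ∈ segment ℝ x₀ x := by
    rw [segment_eq_image_lineMap]
    exact Set.mem_image_of_mem _ ⟨by positivity, ht₁⟩
  have hmax := hf.le_max_of_mem_segment (Set.mem_univ _) (Set.mem_univ _) hseg
  rw [max_eq_left hx] at hmax
  exact (hsphere _ hz).not_ge hmax

/-- deterministic convex argmin-convergence lemma. If convex functions
f_n converge pointwise to a convex function f with unique global minimizer x*, and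
x_n is a global minimizer of f_n, then x_n → x*. -/
theorem convex_argmin_convergence (d : ℕ)
    (f : ℕ → (Fin d → ℝ) → ℝ) (flim : (Fin d → ℝ) → ℝ)
    (hfconv : ∀ n, ConvexOn ℝ Set.univ (f n))
    (hflimconv : ConvexOn ℝ Set.univ flim)
    (hpt : ∀ x, Tendsto (fun n => f n x) atTop (nhds (flim x)))
    (xstar : Fin d → ℝ)
    (hmin : ∀ x, x ≠ xstar → flim xstar < flim x)
    (xn : ℕ → Fin d → ℝ)
    (hxn : ∀ n x, f n (xn n) ≤ f n x) :
    Tendsto xn atTop (nhds xstar) := by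
  refine Metric.tendsto_nhds.2 fun r hr => ?_
  have hlocal : ∀ y ∈ Metric.sphere xstar r,
      ∀ᶠ p in atTop ×ˢ nhds y, f p.1 xstar < f p.1 p.2 := by
    intro y hy
    obtain ⟨c, hc, hcy⟩ := exists_between (hmin y (Metric.ne_of_mem_sphere hy hr.ne'))
    filter_upwards [ConvexOn.eventually_prod_nhds_lt_of_tendsto hfconv hflimconv hpt hcy,
      ((hpt xstar).eventually_lt_const hc).prod_inl (nhds y)] with p hp hp'
    exact hp'.trans hp
  have hsphere : ∀ᶠ n in atTop, ∀ z ∈ Metric.sphere xstar r, f n xstar < f n z := by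
    have hprod : ∀ᶠ p in atTop ×ˢ nhdsSet (Metric.sphere xstar r), f p.1 xstar < f p.1 p.2 :=
      (isCompact_sphere xstar r).mem_prod_nhdsSet_of_forall hlocal
    exact hprod.curry.mono fun _ h => h.self_of_nhdsSet
  filter_upwards [hsphere] with n hn
  exact (hfconv n).dist_lt_of_forall_sphere_lt hr hn (hxn n xstar)
end
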